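/- arXiv:2409.00219 — 2 statements merged into one kernel-verified Lean document; each statement's English description precedes it below -/
import Mathlib

section
/- Let R be a commutative ring, δ : R → R a derivation, and let d₁, d₂ be N×N matrices over R. Suppose P is an invertible N×N matrix over R with d₂ = P·d₁·P⁻¹. Then, setting H := P^δ·P⁻¹ (entrywise derivative of P times the inverse of P), one has d₂^δ − P·d₁^δ·P⁻¹ = H·d₂ − d₂·H. In particular, the entrywise derivatives of two matrix expressions of the same endomorphism with respect to different bases are chain homotopic in the endomorphism complex. -/
/-- The Leibniz rule for the entrywise application of a derivation to a product of matrices. -/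
theorem Matrix.map_mul_of_leibniz {R l m n : Type*} [CommRing R] [Fintype m] (δ : R → R)
    (hadd : ∀ a b : R, δ (a + b) = δ a + δ b)
    (hmul : ∀ a b : R, δ (a * b) = δ a * b + a * δ b)
    (A : Matrix l m R) (B : Matrix m n R) :
    (A * B).map δ = A.map δ * B + A * B.map δ := by
  ext i j
  simp only [Matrix.map_apply, Matrix.add_apply, Matrix.mul_apply]
  rw [← Finset.sum_add_distrib]
  exact (map_sum (AddMonoidHom.mk' δ hadd) _ _).trans
    (Finset.sum_congr rfl fun k _ => hmul _ _)

/-- If `d₂ = P·d₁·P⁻¹` for an invertible matrix `P`, then with `H := P^δ·P⁻¹`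
one has `d₂^δ − P·d₁^δ·P⁻¹ = H·d₂ − d₂·H`: the entrywise derivatives of two
matrix expressions of the same endomorphism with respect to different bases are
chain homotopic. -/
theorem matrix_derivative_basis_independent_up_to_homotopy
    {R : Type*} [CommRing R] (δ : R → R)
    (hadd : ∀ a b : R, δ (a + b) = δ a + δ b)
    (hmul : ∀ a b : R, δ (a * b) = δ a * b + a * δ b)
    {N : ℕ} (d₁ d₂ P : Matrix (Fin N) (Fin N) R)
    [Invertible P]
    (h : d₂ = P * d₁ * ⅟P) :
    d₂.map δ - P * d₁.map δ * ⅟P = (P.map δ * ⅟P) * d₂ - d₂ * (P.map δ * ⅟P) := by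
  have hcomm : d₂ * P = P * d₁ := by
    rw [h, Matrix.mul_assoc, invOf_mul_self, Matrix.mul_one]
  have hderiv : d₂.map δ * P + d₂ * P.map δ = P.map δ * d₁ + P * d₁.map δ := by
    rw [← Matrix.map_mul_of_leibniz δ hadd hmul, hcomm, Matrix.map_mul_of_leibniz δ hadd hmul]
  have hconj : P.map δ * ⅟P * d₂ = P.map δ * d₁ * ⅟P := by
    rw [h, Matrix.mul_assoc P, Matrix.mul_assoc (P.map δ), ← Matrix.mul_assoc (⅟P),
      invOf_mul_self, Matrix.one_mul, Matrix.mul_assoc]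
  have hright := congrArg (· * ⅟P) hderiv
  simp only [Matrix.add_mul] at hright
  rw [Matrix.mul_assoc (d₂.map δ), mul_invOf_self, Matrix.mul_one, Matrix.mul_assoc d₂] at hright
  rw [hconj, sub_eq_sub_iff_add_eq_add, hright]
end

section
/- Let R be a commutative ring and v, w ∈ R. Let (A, B) be a matrix factorization of v with components A an n₁×n₀ matrix and B an n₀×n₁ matrix satisfying A·B = v·1 and B·A = v·1, and let (C, D′) be a matrix factorization of w with components C an m₁×m₀ matrix and D′ an m₀×m₁ matrix satisfying C·D′ = w·1 and D′·C = w·1. Define the block matrices, built from Kronecker products, E := [[A⊗1_{m₀}, −1_{n₁}⊗D′], [1_{n₀}⊗C, B⊗1_{m₁}]] (mapping the index set n₀×m₀ ⊔ n₁×m₁ to n₁×m₀ ⊔ n₀×m₁) and F := [[B⊗1_{m₀}, 1_{n₀}⊗D′], [−1_{n₁}⊗C, A⊗1_{m₁}]]. Then F·E = (v+w)·1 and E·F = (v+w)·1. That is, the ℤ₂-graded tensor product of the two matrix factorizations, with differential d_M ⊗ 1 + 1 ⊗ d_N, is a matrix factorization of v + w. -/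
open Matrix Kronecker

/-- The ℤ₂-graded tensor product of a matrix factorization `(A, B)` of `v` and
a matrix factorization `(C, D′)` of `w`, with differential
`d_M ⊗ 1 + 1 ⊗ d_N` (encoded by the block matrices `E` and `F` below), is a
matrix factorization of `v + w`: `F·E = (v+w)·1` and `E·F = (v+w)·1`. -/
theorem tensor_of_matrix_factorizations
    {R : Type*} [CommRing R] (v w : R) {n₀ n₁ m₀ m₁ : ℕ}
    (A : Matrix (Fin n₁) (Fin n₀) R) (B : Matrix (Fin n₀) (Fin n₁) R)
    (C : Matrix (Fin m₁) (Fin m₀) R) (D' : Matrix (Fin m₀) (Fin m₁) R)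
    (hAB : A * B = v • (1 : Matrix (Fin n₁) (Fin n₁) R))
    (hBA : B * A = v • (1 : Matrix (Fin n₀) (Fin n₀) R))
    (hCD : C * D' = w • (1 : Matrix (Fin m₁) (Fin m₁) R))
    (hDC : D' * C = w • (1 : Matrix (Fin m₀) (Fin m₀) R))
    (E : Matrix ((Fin n₁ × Fin m₀) ⊕ (Fin n₀ × Fin m₁))
      ((Fin n₀ × Fin m₀) ⊕ (Fin n₁ × Fin m₁)) R)
    (F : Matrix ((Fin n₀ × Fin m₀) ⊕ (Fin n₁ × Fin m₁))
      ((Fin n₁ × Fin m₀) ⊕ (Fin n₀ × Fin m₁)) R)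
    (hE : E = Matrix.fromBlocks
      (A ⊗ₖ (1 : Matrix (Fin m₀) (Fin m₀) R))
      (-((1 : Matrix (Fin n₁) (Fin n₁) R) ⊗ₖ D'))
      ((1 : Matrix (Fin n₀) (Fin n₀) R) ⊗ₖ C)
      (B ⊗ₖ (1 : Matrix (Fin m₁) (Fin m₁) R)))
    (hF : F = Matrix.fromBlocks
      (B ⊗ₖ (1 : Matrix (Fin m₀) (Fin m₀) R))
      ((1 : Matrix (Fin n₀) (Fin n₀) R) ⊗ₖ D')
      (-((1 : Matrix (Fin n₁) (Fin n₁) R) ⊗ₖ C))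
      (A ⊗ₖ (1 : Matrix (Fin m₁) (Fin m₁) R))) :
    F * E = (v + w) • 1 ∧ E * F = (v + w) • 1 := by
  subst hE hF
  constructor <;>
    simp [fromBlocks_multiply, ← mul_kronecker_mul, hAB, hBA, hCD, hDC, smul_kronecker,
      kronecker_smul, ← fromBlocks_one, fromBlocks_smul, fromBlocks_add, add_smul, add_comm]
end
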